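/- The kernel of the Dirac operator D̸ on F × F equals the product of the range of D₁ and the range of D₂: ker D̸ = {(D₁φ, D₂ψ) : φ, ψ ∈ F}; in particular for every φ ∈ F one has D̸(D₁φ, 0) = 0 and D̸(0, D₂φ) = 0. -/

import Mathlib

noncomputable section
open DihedralGroup Complex

abbrev D6 := DihedralGroup 6
/-- the reflection `s` -/
def s : D6 := DihedralGroup.sr 0
/-- the rotation `r` of order 6 -/
def rot : D6 := DihedralGroup.r 1
/-- `t = s*r` -/
def t : D6 := s * rot
/-- `x = s*r^3` -/
def x : D6 := s * rot ^ 3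
/-- `y = s*r^5` -/
def y : D6 := s * rot ^ 5
/-- `F` is the space of complex-valued functions on `D₆`. -/
abbrev F := D6 → ℂ

/-- The right-translation operator `(R_a f)(g) = f(g·a)`. -/
def R (a : D6) : Module.End ℂ F := LinearMap.funLeft ℂ ℂ (fun g => g * a)

/-- `ω = exp(iπ/3)`. -/
def ω : ℂ := Complex.exp (Real.pi * Complex.I / 3)

/-- `D₀ = R_t + R_x + R_y`. -/
def D₀ : Module.End ℂ F := R t + R x + R y

/-- `D₁ = ω·R_t + ω³·R_x + ω⁵·R_y`. -/
def D₁ : Module.End ℂ F := ω • R t + ω ^ 3 • R x + ω ^ 5 • R y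

/-- `D₂ = ω⁻¹·R_t + ω⁻³·R_x + ω⁻⁵·R_y`. -/
def D₂ : Module.End ℂ F := ω⁻¹ • R t + (ω ^ 3)⁻¹ • R x + (ω ^ 5)⁻¹ • R y

/-- The Dirac operator `D̸(f₁, f₂) = (−D₀f₁ + D₂f₂, D₁f₁ − D₀f₂)` on `F × F`. -/
def Dir : Module.End ℂ (F × F) :=
  LinearMap.prod (D₂ ∘ₗ LinearMap.snd ℂ F F - D₀ ∘ₗ LinearMap.fst ℂ F F)
    (D₁ ∘ₗ LinearMap.fst ℂ F F - D₀ ∘ₗ LinearMap.snd ℂ F F)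

/-- `ω` is a root of the sixth cyclotomic polynomial `X² - X + 1`. -/
theorem omega_sq : ω ^ 2 = ω - 1 := by
  have h : ω = 1 / 2 + (√3 / 2 : ℝ) * Complex.I := by
    have h' : (Real.pi * Complex.I / 3 : ℂ) = ((Real.pi / 3 : ℝ) : ℂ) * Complex.I := by
      push_cast; ring
    rw [ω, h', Complex.exp_mul_I, ← Complex.ofReal_cos, ← Complex.ofReal_sin,
      Real.cos_pi_div_three, Real.sin_pi_div_three]
    push_cast; ring
  have h3 : ((√3 : ℝ) : ℂ) ^ 2 = 3 := by
    rw [← Complex.ofReal_pow, Real.sq_sqrt (by norm_num)]; norm_num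
  rw [h]
  push_cast
  linear_combination (Complex.I ^ 2 / 4) * h3 + (3 / 4) * Complex.I_sq

theorem omega_pow_three : ω ^ 3 = -1 := by
  linear_combination (ω + 1) * omega_sq

theorem omega_pow_five : ω ^ 5 = 1 - ω := by
  linear_combination ω ^ 2 * omega_pow_three - omega_sq

theorem omega_inv : ω⁻¹ = 1 - ω :=
  inv_eq_of_mul_eq_one_right (by linear_combination -omega_sq)

theorem one_sub_omega_inv : (1 - ω)⁻¹ = ω := by
  rw [← omega_inv, inv_inv]

theorem R_apply_apply (a : D6) (f : F) (g : D6) : R a f g = f (g * a) := rfl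

theorem D₀_apply (f : F) (g : D6) : D₀ f g = f (g * t) + f (g * x) + f (g * y) := rfl

theorem D₁_apply (f : F) (g : D6) :
    D₁ f g = ω * f (g * t) - f (g * x) + (1 - ω) * f (g * y) := by
  simp [D₁, R_apply_apply, omega_pow_three, omega_pow_five, sub_eq_add_neg]

theorem D₂_apply (f : F) (g : D6) :
    D₂ f g = (1 - ω) * f (g * t) - f (g * x) + ω * f (g * y) := by
  simp only [D₂, R_apply_apply, omega_pow_three, omega_pow_five, omega_inv, one_sub_omega_inv,
    LinearMap.add_apply, LinearMap.smul_apply, Pi.add_apply, Pi.smul_apply, smul_eq_mul]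
  norm_num [sub_eq_add_neg]

theorem t_mul_t : t * t = 1 := by decide
theorem t_mul_x : t * x = r 2 := by decide
theorem t_mul_y : t * y = r 4 := by decide
theorem x_mul_t : x * t = r 4 := by decide
theorem x_mul_x : x * x = 1 := by decide
theorem x_mul_y : x * y = r 2 := by decide
theorem y_mul_t : y * t = r 2 := by decide
theorem y_mul_x : y * x = r 4 := by decide
theorem y_mul_y : y * y = 1 := by decide

theorem D₀_D₁ (f : F) : D₀ (D₁ f) = 0 := by
  ext g
  simp only [D₀_apply, D₁_apply, mul_assoc, t_mul_t, t_mul_x, t_mul_y, x_mul_t, x_mul_x, x_mul_y,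
    y_mul_t, y_mul_x, y_mul_y, Pi.zero_apply]
  ring

theorem D₀_D₂ (f : F) : D₀ (D₂ f) = 0 := by
  ext g
  simp only [D₀_apply, D₂_apply, mul_assoc, t_mul_t, t_mul_x, t_mul_y, x_mul_t, x_mul_x, x_mul_y,
    y_mul_t, y_mul_x, y_mul_y, Pi.zero_apply]
  ring

theorem D₁_D₀ (f : F) : D₁ (D₀ f) = 0 := by
  ext g
  simp only [D₀_apply, D₁_apply, mul_assoc, t_mul_t, t_mul_x, t_mul_y, x_mul_t, x_mul_x, x_mul_y,
    y_mul_t, y_mul_x, y_mul_y, Pi.zero_apply]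
  ring

theorem D₂_D₀ (f : F) : D₂ (D₀ f) = 0 := by
  ext g
  simp only [D₀_apply, D₂_apply, mul_assoc, t_mul_t, t_mul_x, t_mul_y, x_mul_t, x_mul_x, x_mul_y,
    y_mul_t, y_mul_x, y_mul_y, Pi.zero_apply]
  ring

theorem D₁_D₁ (f : F) : D₁ (D₁ f) = 0 := by
  ext g
  simp only [D₁_apply, mul_assoc, t_mul_t, t_mul_x, t_mul_y, x_mul_t, x_mul_x, x_mul_y,
    y_mul_t, y_mul_x, y_mul_y, Pi.zero_apply]
  grind [omega_sq]

theorem D₂_D₂ (f : F) : D₂ (D₂ f) = 0 := by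
  ext g
  simp only [D₂_apply, mul_assoc, t_mul_t, t_mul_x, t_mul_y, x_mul_t, x_mul_x, x_mul_y,
    y_mul_t, y_mul_x, y_mul_y, Pi.zero_apply]
  grind [omega_sq]

/-- The squares of the components of the Dirac operator resolve the identity, up to a factor. -/
theorem D₀_D₀_add_D₁_D₂_add_D₂_D₁ (f : F) :
    D₀ (D₀ f) + D₁ (D₂ f) + D₂ (D₁ f) = (9 : ℂ) • f := by
  ext g
  simp only [D₀_apply, D₁_apply, D₂_apply, mul_assoc, t_mul_t, t_mul_x, t_mul_y, x_mul_t, x_mul_x,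
    x_mul_y, y_mul_t, y_mul_x, y_mul_y, Pi.add_apply, Pi.smul_apply, smul_eq_mul, mul_one]
  grind [omega_sq]

theorem Dir_apply (f₁ f₂ : F) : Dir (f₁, f₂) = (D₂ f₂ - D₀ f₁, D₁ f₁ - D₀ f₂) := rfl

/-- The kernel of the Dirac operator `D̸` on `F × F` equals the product of the range of
`D₁` and the range of `D₂`; in particular `D̸(D₁φ, 0) = 0` and `D̸(0, D₂φ) = 0` for all
`φ ∈ F`. -/
theorem ker_dirac_eq_range_prod :
    LinearMap.ker Dir = (LinearMap.range D₁).prod (LinearMap.range D₂) ∧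
    ∀ φ : F, Dir (D₁ φ, 0) = 0 ∧ Dir (0, D₂ φ) = 0 := by
  refine ⟨?_, fun φ => ⟨?_, ?_⟩⟩
  · ext ⟨f₁, f₂⟩
    rw [LinearMap.mem_ker, Submodule.mem_prod, Dir_apply, Prod.mk_eq_zero, sub_eq_zero, sub_eq_zero]
    constructor
    · rintro ⟨h₁, h₂⟩
      have h₁₀ : D₀ (D₀ f₁) = 0 := by rw [← h₁, D₀_D₂]
      have h₂₀ : D₀ (D₀ f₂) = 0 := by rw [← h₂, D₀_D₁]
      have h₁₂ : D₂ (D₁ f₁) = 0 := by rw [h₂, D₂_D₀]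
      have h₂₁ : D₁ (D₂ f₂) = 0 := by rw [h₁, D₁_D₀]
      have e₁ := D₀_D₀_add_D₁_D₂_add_D₂_D₁ f₁
      have e₂ := D₀_D₀_add_D₁_D₂_add_D₂_D₁ f₂
      rw [h₁₀, h₁₂, zero_add, add_zero] at e₁
      rw [h₂₀, h₂₁, zero_add, zero_add] at e₂
      refine ⟨⟨(9 : ℂ)⁻¹ • D₂ f₁, ?_⟩, ⟨(9 : ℂ)⁻¹ • D₁ f₂, ?_⟩⟩
      · rw [map_smul, e₁, inv_smul_smul₀ (by norm_num)]
      · rw [map_smul, e₂, inv_smul_smul₀ (by norm_num)]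
    · rintro ⟨⟨φ, rfl⟩, ⟨ψ, rfl⟩⟩
      simp only [D₂_D₂, D₀_D₁, D₁_D₁, D₀_D₂, and_self]
  · simp [Dir_apply, D₀_D₁, D₁_D₁]
  · simp [Dir_apply, D₀_D₂, D₂_D₂]
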